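/- arXiv:2003.07959 — 5 statements merged into one kernel-verified Lean document; each statement's English description precedes it below -/
import Mathlib

section
/- Let n ≥ 1, k ≥ 1, let x_1,…,x_n ∈ ℝ^k be samples with Euclidean norm ‖x_i‖₂ ≤ l for some l > 0, let w ∈ ℝ^k with ‖w‖₂ = 1, and let c1, c2 > 0 satisfy c1 ≤ 2l and c1·c2 ≥ 8·√n·l². Define R(b) = Σ_{i=1}^n f(w·x_i + b). If b ∈ ℝ is a point where R′(b) = 0 (the model has converged), then every sample satisfies w·x_i + b ≥ −c1/√3, and at least one sample x_j satisfies w·x_j + b ≤ 0; that is, the learned inequality w·x + b ≥ 0 is within distance c1/√3 of a 'desired' inequality (one valid for all samples and tight at some sample). -/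
open scoped RealInnerProductSpace

/-- The Piecewise Biased Quadratic Unit (PBQU) activation. -/
noncomputable def pbqu (c1 c2 : ℝ) (x : ℝ) : ℝ :=
  if x < 0 then c1 ^ 2 / (x ^ 2 + c1 ^ 2) else c2 ^ 2 / (x ^ 2 + c2 ^ 2)

/-- The derivative of `pbqu c1 c2`. -/
noncomputable def pbquDeriv (c1 c2 : ℝ) (x : ℝ) : ℝ :=
  if x < 0 then -(2 * x * c1 ^ 2) / (x ^ 2 + c1 ^ 2) ^ 2
  else -(2 * x * c2 ^ 2) / (x ^ 2 + c2 ^ 2) ^ 2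

theorem hasDerivAt_sq_div_sq_add_sq {c : ℝ} (hc : 0 < c) (x : ℝ) :
    HasDerivAt (fun y : ℝ => c ^ 2 / (y ^ 2 + c ^ 2))
      (-(2 * x * c ^ 2) / (x ^ 2 + c ^ 2) ^ 2) x := by
  have hden : HasDerivAt (fun y : ℝ => y ^ 2 + c ^ 2) (2 * x) x := by
    simpa using (hasDerivAt_pow 2 x).add_const (c ^ 2)
  have hne : x ^ 2 + c ^ 2 ≠ 0 := by positivity
  exact ((hasDerivAt_const x (c ^ 2)).fun_div hden hne).congr_deriv (by ring)

theorem hasDerivAt_pbqu {c1 c2 : ℝ} (hc1 : 0 < c1) (hc2 : 0 < c2) (x : ℝ) :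
    HasDerivAt (pbqu c1 c2) (pbquDeriv c1 c2 x) x := by
  rcases lt_trichotomy x 0 with h | rfl | h
  · rw [pbquDeriv, if_pos h]
    refine (hasDerivAt_sq_div_sq_add_sq hc1 x).congr_of_eventuallyEq ?_
    filter_upwards [Iio_mem_nhds h] with y hy
    exact if_pos hy
  · have hd : pbquDeriv c1 c2 0 = 0 := by simp [pbquDeriv]
    have hleft : HasDerivWithinAt (pbqu c1 c2) 0 (Set.Iic 0) 0 := by
      have hd1 := (hasDerivAt_sq_div_sq_add_sq hc1 0).hasDerivWithinAt (s := Set.Iic 0)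
      simp only [mul_zero, zero_mul, neg_zero, zero_div] at hd1
      refine hd1.congr_of_mem (fun y hy => ?_) Set.self_mem_Iic
      rcases (Set.mem_Iic.mp hy).lt_or_eq with hy | rfl
      · exact if_pos hy
      · simp [pbqu, hc1.ne', hc2.ne']
    have hright : HasDerivWithinAt (pbqu c1 c2) 0 (Set.Ici 0) 0 := by
      have hd2 := (hasDerivAt_sq_div_sq_add_sq hc2 0).hasDerivWithinAt (s := Set.Ici 0)
      simp only [mul_zero, zero_mul, neg_zero, zero_div] at hd2
      exact hd2.congr_of_mem (fun y hy => if_neg (not_lt.mpr hy)) Set.self_mem_Ici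
    rw [hd]
    simpa using hleft.union hright
  · rw [pbquDeriv, if_neg h.not_gt]
    refine (hasDerivAt_sq_div_sq_add_sq hc2 x).congr_of_eventuallyEq ?_
    filter_upwards [Ioi_mem_nhds h] with y hy
    exact if_neg (not_lt.mpr (le_of_lt hy))

theorem pbquDeriv_pos {c1 : ℝ} (c2 : ℝ) (hc1 : 0 < c1) {x : ℝ} (hx : x < 0) :
    0 < pbquDeriv c1 c2 x := by
  rw [pbquDeriv, if_pos hx]
  have : 0 < -(2 * x * c1 ^ 2) := by nlinarith [pow_pos hc1 2]
  positivity

theorem pbquDeriv_neg (c1 : ℝ) {c2 : ℝ} (hc2 : 0 < c2) {x : ℝ} (hx : 0 < x) :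
    pbquDeriv c1 c2 x < 0 := by
  rw [pbquDeriv, if_neg hx.not_gt, neg_div]
  exact neg_neg_of_pos (by positivity)

theorem neg_div_sq_le_pbquDeriv {c1 c2 x M : ℝ} (hc1 : 0 < c1) (hc2 : 0 < c2) (hM : 0 ≤ M)
    (hx : x ≤ M) : -(2 * M / c2 ^ 2) ≤ pbquDeriv c1 c2 x := by
  rcases lt_or_ge x 0 with h | h
  · exact (neg_nonpos.mpr (by positivity)).trans (pbquDeriv_pos c2 hc1 h).le
  · rw [pbquDeriv, if_neg h.not_gt, neg_div, neg_le_neg_iff,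
      div_le_div_iff₀ (by positivity) (by positivity)]
    calc 2 * x * c2 ^ 2 * c2 ^ 2 = 2 * x * (c2 ^ 2) ^ 2 := by ring
      _ ≤ 2 * M * (x ^ 2 + c2 ^ 2) ^ 2 := by
        gcongr
        nlinarith [sq_nonneg x]

theorem sq_add_sq_sq_le {a c L : ℝ} (ha : 0 < a) (hc : 0 < c) (haL : a ≤ L) (hcL : c ≤ L)
    (hca : c ^ 2 ≤ 3 * a ^ 2) : (a ^ 2 + c ^ 2) ^ 2 ≤ 4 * a * L ^ 3 := by
  have hL : 0 < L := ha.trans_le haL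
  rcases le_total (L ^ 2) (3 * a ^ 2) with h | h
  · have hhalf : L ≤ 2 * a := by nlinarith
    have hfac : 0 ≤ (L - a) * (a ^ 3 + a ^ 2 * L + 3 * a * L ^ 2 - L ^ 3) := by
      refine mul_nonneg (sub_nonneg.mpr haL) ?_
      have h1 : L ^ 2 * L ≤ L ^ 2 * (2 * a) := by gcongr
      have h2 : 0 < a ^ 3 + a ^ 2 * L + a * L ^ 2 := by positivity
      nlinarith
    calc (a ^ 2 + c ^ 2) ^ 2 ≤ (a ^ 2 + L ^ 2) ^ 2 := by gcongr
      _ ≤ 4 * a * L ^ 3 := by nlinarith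
  · have hthree : 4 * a ≤ 3 * L := by nlinarith
    have hcube : 4 * a ^ 3 ≤ L ^ 3 := by
      have h1 : 4 * a * (3 * a ^ 2) ≤ 3 * L * L ^ 2 := by gcongr
      nlinarith
    calc (a ^ 2 + c ^ 2) ^ 2 ≤ (a ^ 2 + 3 * a ^ 2) ^ 2 := by gcongr
      _ = 4 * a * (4 * a ^ 3) := by ring
      _ ≤ 4 * a * L ^ 3 := by gcongr

theorem sq_div_le_pbquDeriv {c1 x L : ℝ} (c2 : ℝ) (hc1 : 0 < c1) (hx : x < 0) (hxL : -x ≤ L)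
    (hcL : c1 ≤ L) (hcx : c1 ^ 2 ≤ 3 * x ^ 2) :
    c1 ^ 2 / (2 * L ^ 3) ≤ pbquDeriv c1 c2 x := by
  have hL : 0 < L := hc1.trans_le hcL
  have key := sq_add_sq_sq_le (neg_pos.mpr hx) hc1 hxL hcL (by simpa using hcx)
  rw [neg_sq] at key
  rw [pbquDeriv, if_pos hx, div_le_div_iff₀ (by positivity) (by positivity)]
  calc c1 ^ 2 * (x ^ 2 + c1 ^ 2) ^ 2 ≤ c1 ^ 2 * (4 * -x * L ^ 3) := by gcongr
    _ = -(2 * x * c1 ^ 2) * (2 * L ^ 3) := by ring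

theorem stmt_0 (n k : ℕ) (hn : 1 ≤ n) (hk : 1 ≤ k)
    (x : Fin n → EuclideanSpace ℝ (Fin k)) (l : ℝ) (hl : 0 < l)
    (hx : ∀ i, ‖x i‖ ≤ l) (w : EuclideanSpace ℝ (Fin k)) (hw : ‖w‖ = 1)
    (c1 c2 : ℝ) (hc1 : 0 < c1) (hc2 : 0 < c2)
    (hc1l : c1 ≤ 2 * l) (hcc : 8 * Real.sqrt n * l ^ 2 ≤ c1 * c2)
    (b : ℝ)
    (hconv : deriv (fun b' => ∑ i, pbqu c1 c2 (⟪w, x i⟫ + b')) b = 0) :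
    (∀ i, -(c1 / Real.sqrt 3) ≤ ⟪w, x i⟫ + b) ∧ (∃ j, ⟪w, x j⟫ + b ≤ 0) := by
  have hsum : ∑ i, pbquDeriv c1 c2 (⟪w, x i⟫ + b) = 0 := by
    rw [← hconv]
    refine (HasDerivAt.fun_sum fun i _ => ?_).deriv.symm
    exact (hasDerivAt_pbqu hc1 hc2 _).comp_const_add ⟪w, x i⟫ b
  have hne : (Finset.univ : Finset (Fin n)).Nonempty := ⟨⟨0, hn⟩, Finset.mem_univ _⟩
  have hinner : ∀ i, |⟪w, x i⟫| ≤ l := fun i => by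
    simpa [hw] using (abs_real_inner_le_norm w (x i)).trans
      (mul_le_mul_of_nonneg_left (hx i) (norm_nonneg w))
  constructor
  · intro i
    by_contra! hi
    have hti : ⟪w, x i⟫ + b < 0 := hi.trans_le (neg_nonpos.mpr (by positivity))
    have hdist : ∀ j, ⟪w, x j⟫ + b ≤ 2 * l + (⟪w, x i⟫ + b) := fun j => by
      linarith [(abs_le.mp (hinner j)).2, (abs_le.mp (hinner i)).1]
    have hbdd : -(⟪w, x i⟫ + b) ≤ 2 * l := by
      obtain ⟨j, hj⟩ : ∃ j, 0 ≤ ⟪w, x j⟫ + b := by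
        by_contra! hall
        exact (Finset.sum_pos (fun j _ => pbquDeriv_pos c2 hc1 (hall j)) hne).ne' hsum
      linarith [hdist j]
    have hcx : c1 ^ 2 ≤ 3 * (⟪w, x i⟫ + b) ^ 2 := by
      have h1 : (c1 / Real.sqrt 3) ^ 2 ≤ (-(⟪w, x i⟫ + b)) ^ 2 := by
        gcongr
        linarith
      rw [div_pow, Real.sq_sqrt (by norm_num), neg_sq] at h1
      linarith
    have hlow := sq_div_le_pbquDeriv c2 hc1 hti hbdd hc1l hcx
    have hoth : ∀ j, -(2 * (2 * l) / c2 ^ 2) ≤ pbquDeriv c1 c2 (⟪w, x j⟫ + b) := fun j =>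
      neg_div_sq_le_pbquDeriv hc1 hc2 (by positivity) (by linarith [hdist j])
    have hscale : n * (2 * (2 * l) / c2 ^ 2) ≤ c1 ^ 2 / (2 * (2 * l) ^ 3) := by
      have h1 : (8 * Real.sqrt n * l ^ 2) ^ 2 ≤ (c1 * c2) ^ 2 := by gcongr
      rw [mul_pow, mul_pow, Real.sq_sqrt (Nat.cast_nonneg n)] at h1
      rw [← mul_div_assoc, div_le_div_iff₀ (by positivity) (by positivity)]
      nlinarith
    have hcard := Finset.card_nsmul_le_sum (Finset.univ.erase i) _ _ fun j _ => hoth j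
    rw [Finset.card_erase_of_mem (Finset.mem_univ i), Finset.card_univ, Fintype.card_fin,
      nsmul_eq_mul, Nat.cast_sub hn, Nat.cast_one] at hcard
    rw [← Finset.add_sum_erase _ _ (Finset.mem_univ i)] at hsum
    have hpos : 0 < 2 * (2 * l) / c2 ^ 2 := by positivity
    linarith
  · by_contra! hall
    exact (Finset.sum_neg (fun j _ => pbquDeriv_neg c1 hc2 (hall j)) hne).ne hsum
end

section
/- Let n ≥ 1, let x_1,…,x_n ∈ ℝ^k, let w ∈ ℝ^k, let b ∈ ℝ, and define R(b) = Σ_{i=1}^n f(w·x_i + b). If every sample violates the inequality, i.e. w·x_i + b < 0 for all i ∈ {1,…,n}, then R′(b) > 0. -/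
open scoped RealInnerProductSpace

/-- On the negative half-line the derivative of `pbqu` is that of its left branch. -/
theorem hasDerivAt_pbqu_of_neg {c1 : ℝ} (c2 : ℝ) {t : ℝ} (hc1 : c1 ≠ 0) (ht : t < 0) :
    HasDerivAt (pbqu c1 c2) (-(2 * c1 ^ 2 * t) / (t ^ 2 + c1 ^ 2) ^ 2) t := by
  have hden : t ^ 2 + c1 ^ 2 ≠ 0 := by positivity
  have hbranch : HasDerivAt (fun y : ℝ => c1 ^ 2 / (y ^ 2 + c1 ^ 2))
      (-(2 * c1 ^ 2 * t) / (t ^ 2 + c1 ^ 2) ^ 2) t := by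
    refine ((hasDerivAt_const t (c1 ^ 2)).fun_div
      (((hasDerivAt_id' t).fun_pow 2).add_const (c1 ^ 2)) hden).congr_deriv ?_
    push_cast
    ring
  refine hbranch.congr_of_eventuallyEq ?_
  filter_upwards [Iio_mem_nhds ht] with y hy
  exact if_pos hy

theorem stmt_1 (n k : ℕ) (hn : 1 ≤ n)
    (x : Fin n → EuclideanSpace ℝ (Fin k)) (w : EuclideanSpace ℝ (Fin k)) (b : ℝ)
    (c1 c2 : ℝ) (hc1 : 0 < c1) (hc2 : 0 < c2)
    (hviol : ∀ i, ⟪w, x i⟫ + b < 0) :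
    0 < deriv (fun b' => ∑ i, pbqu c1 c2 (⟪w, x i⟫ + b')) b := by
  have hderiv := HasDerivAt.fun_sum (u := Finset.univ) fun i _ =>
    (hasDerivAt_pbqu_of_neg c2 hc1.ne' (hviol i)).comp_const_add ⟪w, x i⟫ b
  rw [hderiv.deriv]
  have : NeZero n := ⟨by omega⟩
  refine Finset.sum_pos (fun i _ => ?_) Finset.univ_nonempty
  refine div_pos (neg_pos.mpr (mul_neg_of_pos_of_neg ?_ (hviol i))) ?_ <;> positivity
end

section
/- Let n ≥ 1, let x_1,…,x_n ∈ ℝ^k, let w ∈ ℝ^k, let b ∈ ℝ, and define R(b) = Σ_{i=1}^n f(w·x_i + b). If every sample strictly satisfies the inequality, i.e. w·x_i + b > 0 for all i ∈ {1,…,n}, then R′(b) < 0; hence at a convergence point at least one sample lies on or beyond the boundary. -/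
open scoped RealInnerProductSpace

theorem hasDerivAt_pbqu_of_pos (c1 : ℝ) {c2 t : ℝ} (ht : 0 < t) :
    HasDerivAt (pbqu c1 c2) (-(c2 ^ 2 * (2 * t)) / (t ^ 2 + c2 ^ 2) ^ 2) t := by
  have hne : t ^ 2 + c2 ^ 2 ≠ 0 := by positivity
  have hden : HasDerivAt (fun y : ℝ => y ^ 2 + c2 ^ 2) (2 * t) t := by
    simpa using (hasDerivAt_pow 2 t).add_const (c2 ^ 2)
  have hquot : HasDerivAt (fun y : ℝ => c2 ^ 2 / (y ^ 2 + c2 ^ 2))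
      (-(c2 ^ 2 * (2 * t)) / (t ^ 2 + c2 ^ 2) ^ 2) t := by
    simpa using (hasDerivAt_const t (c2 ^ 2)).fun_div hden hne
  refine hquot.congr_of_eventuallyEq ?_
  filter_upwards [lt_mem_nhds ht] with y hy
  simp [pbqu, not_lt.mpr hy.le]

theorem stmt_3 (n k : ℕ) (hn : 1 ≤ n)
    (x : Fin n → EuclideanSpace ℝ (Fin k)) (w : EuclideanSpace ℝ (Fin k)) (b : ℝ)
    (c1 c2 : ℝ) (hc1 : 0 < c1) (hc2 : 0 < c2)
    (hsat : ∀ i, 0 < ⟪w, x i⟫ + b) :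
    deriv (fun b' => ∑ i, pbqu c1 c2 (⟪w, x i⟫ + b')) b < 0 := by
  have hderiv : HasDerivAt (fun b' => ∑ i, pbqu c1 c2 (⟪w, x i⟫ + b'))
      (∑ i, -(c2 ^ 2 * (2 * (⟪w, x i⟫ + b))) / ((⟪w, x i⟫ + b) ^ 2 + c2 ^ 2) ^ 2) b :=
    HasDerivAt.fun_sum fun i _ => (hasDerivAt_pbqu_of_pos c1 (hsat i)).comp_const_add _ _
  rw [hderiv.deriv]
  refine Finset.sum_neg (fun i _ => ?_) ⟨⟨0, hn⟩, Finset.mem_univ _⟩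
  have hi := hsat i
  exact div_neg_of_neg_of_pos (neg_neg_of_pos (by positivity)) (by positivity)
end

section
/- For any constants c1, c2 > 0, the derivative f′ of the PBQU f is strictly increasing on the interval (−∞, −c1/√3), strictly decreasing on the interval (−c1/√3, c2/√3), and strictly increasing on the interval (c2/√3, +∞). -/
/-- The derivative of `x ↦ c ^ 2 / (x ^ 2 + c ^ 2)`. -/
noncomputable def quadSlope (c x : ℝ) : ℝ := -2 * c ^ 2 * x / (x ^ 2 + c ^ 2) ^ 2

lemma hasDerivAt_quad {c : ℝ} (hc : 0 < c) (x : ℝ) :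
    HasDerivAt (fun y : ℝ => c ^ 2 / (y ^ 2 + c ^ 2)) (quadSlope c x) x := by
  have hne : x ^ 2 + c ^ 2 ≠ 0 := by positivity
  have hden : HasDerivAt (fun y : ℝ => y ^ 2 + c ^ 2) (2 * x) x := by
    simpa using (hasDerivAt_pow 2 x).add_const (c ^ 2)
  refine ((hasDerivAt_const x (c ^ 2)).fun_div hden hne).congr_deriv ?_
  unfold quadSlope
  ring

lemma hasDerivAt_quadSlope {c : ℝ} (hc : 0 < c) (x : ℝ) :
    HasDerivAt (quadSlope c) (2 * c ^ 2 * (3 * x ^ 2 - c ^ 2) / (x ^ 2 + c ^ 2) ^ 3) x := by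
  have hne : x ^ 2 + c ^ 2 ≠ 0 := by positivity
  have hden : HasDerivAt (fun y : ℝ => y ^ 2 + c ^ 2) (2 * x) x := by
    simpa using (hasDerivAt_pow 2 x).add_const (c ^ 2)
  have hnum : HasDerivAt (fun y : ℝ => -2 * c ^ 2 * y) (-2 * c ^ 2) x := by
    simpa only [mul_one, id] using (hasDerivAt_id x).const_mul (-2 * c ^ 2)
  refine (hnum.fun_div (hden.fun_pow 2) (pow_ne_zero 2 hne)).congr_deriv ?_
  field_simp
  ring

lemma strictMonoOn_quadSlope {c : ℝ} (hc : 0 < c) {s : Set ℝ} (hs : Convex ℝ s)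
    (h : ∀ x ∈ interior s, c ^ 2 < 3 * x ^ 2) : StrictMonoOn (quadSlope c) s := by
  refine strictMonoOn_of_deriv_pos hs
    (fun x _ => (hasDerivAt_quadSlope hc x).continuousAt.continuousWithinAt) fun x hx => ?_
  rw [(hasDerivAt_quadSlope hc x).deriv]
  have := sub_pos.2 (h x hx)
  positivity

lemma strictAntiOn_quadSlope {c : ℝ} (hc : 0 < c) {s : Set ℝ} (hs : Convex ℝ s)
    (h : ∀ x ∈ interior s, 3 * x ^ 2 < c ^ 2) : StrictAntiOn (quadSlope c) s := by
  refine strictAntiOn_of_deriv_neg hs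
    (fun x _ => (hasDerivAt_quadSlope hc x).continuousAt.continuousWithinAt) fun x hx => ?_
  rw [(hasDerivAt_quadSlope hc x).deriv]
  exact div_neg_of_neg_of_pos
    (mul_neg_of_pos_of_neg (by positivity) (sub_neg.2 (h x hx))) (by positivity)

lemma pbqu_of_nonpos {c1 c2 : ℝ} (hc1 : 0 < c1) (hc2 : 0 < c2) {x : ℝ} (hx : x ≤ 0) :
    pbqu c1 c2 x = c1 ^ 2 / (x ^ 2 + c1 ^ 2) := by
  rcases hx.lt_or_eq with h | rfl
  · simp [pbqu, h]
  · simp [pbqu, hc1.ne', hc2.ne']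

lemma pbqu_of_nonneg {c1 c2 : ℝ} {x : ℝ} (hx : 0 ≤ x) :
    pbqu c1 c2 x = c2 ^ 2 / (x ^ 2 + c2 ^ 2) := by
  simp [pbqu, hx.not_gt]

lemma hasDerivAt_pbqu_zero {c1 c2 : ℝ} (hc1 : 0 < c1) (hc2 : 0 < c2) :
    HasDerivAt (pbqu c1 c2) 0 0 := by
  have hl : HasDerivWithinAt (pbqu c1 c2) 0 (Set.Iic 0) 0 := by
    have h := (hasDerivAt_quad hc1 0).hasDerivWithinAt (s := Set.Iic 0)
    simp only [quadSlope, mul_zero, zero_div] at h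
    exact h.congr (fun x hx => pbqu_of_nonpos hc1 hc2 hx) (pbqu_of_nonpos hc1 hc2 le_rfl)
  have hr : HasDerivWithinAt (pbqu c1 c2) 0 (Set.Ici 0) 0 := by
    have h := (hasDerivAt_quad hc2 0).hasDerivWithinAt (s := Set.Ici 0)
    simp only [quadSlope, mul_zero, zero_div] at h
    exact h.congr (fun x hx => pbqu_of_nonneg hx) (pbqu_of_nonneg le_rfl)
  simpa [Set.Iic_union_Ici] using hl.union hr

lemma deriv_pbqu_of_nonpos {c1 c2 : ℝ} (hc1 : 0 < c1) (hc2 : 0 < c2) {x : ℝ} (hx : x ≤ 0) :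
    deriv (pbqu c1 c2) x = quadSlope c1 x := by
  rcases hx.lt_or_eq with h | rfl
  · refine ((hasDerivAt_quad hc1 x).congr_of_eventuallyEq ?_).deriv
    filter_upwards [Iio_mem_nhds h] with y hy using pbqu_of_nonpos hc1 hc2 (le_of_lt hy)
  · simp [(hasDerivAt_pbqu_zero hc1 hc2).deriv, quadSlope]

lemma deriv_pbqu_of_nonneg {c1 c2 : ℝ} (hc1 : 0 < c1) (hc2 : 0 < c2) {x : ℝ} (hx : 0 ≤ x) :
    deriv (pbqu c1 c2) x = quadSlope c2 x := by
  rcases hx.lt_or_eq with h | rfl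
  · refine ((hasDerivAt_quad hc2 x).congr_of_eventuallyEq ?_).deriv
    filter_upwards [Ioi_mem_nhds h] with y hy using pbqu_of_nonneg (le_of_lt hy)
  · simp [(hasDerivAt_pbqu_zero hc1 hc2).deriv, quadSlope]

lemma three_mul_div_sqrt_three_sq (c : ℝ) : 3 * (c / Real.sqrt 3) ^ 2 = c ^ 2 := by
  rw [div_pow, Real.sq_sqrt (by norm_num)]
  ring

theorem stmt_5 (c1 c2 : ℝ) (hc1 : 0 < c1) (hc2 : 0 < c2) :
    StrictMonoOn (deriv (pbqu c1 c2)) (Set.Iio (-(c1 / Real.sqrt 3))) ∧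
    StrictAntiOn (deriv (pbqu c1 c2)) (Set.Ioo (-(c1 / Real.sqrt 3)) (c2 / Real.sqrt 3)) ∧
    StrictMonoOn (deriv (pbqu c1 c2)) (Set.Ioi (c2 / Real.sqrt 3)) := by
  have h1 : 0 < c1 / Real.sqrt 3 := by positivity
  have h2 : 0 < c2 / Real.sqrt 3 := by positivity
  have e1 := three_mul_div_sqrt_three_sq c1
  have e2 := three_mul_div_sqrt_three_sq c2
  set a := c1 / Real.sqrt 3
  set b := c2 / Real.sqrt 3
  refine ⟨?_, ?_, ?_⟩
  · refine (strictMonoOn_quadSlope hc1 (convex_Iio _) fun x hx => ?_).congr fun x hx =>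
      (deriv_pbqu_of_nonpos hc1 hc2 ?_).symm
    · rw [interior_Iio, Set.mem_Iio] at hx
      nlinarith
    · rw [Set.mem_Iio] at hx
      linarith
  · have hl : StrictAntiOn (deriv (pbqu c1 c2)) (Set.Ioc (-a) 0) := by
      refine (strictAntiOn_quadSlope hc1 (convex_Ioc _ _) fun x hx => ?_).congr fun x hx =>
        (deriv_pbqu_of_nonpos hc1 hc2 hx.2).symm
      rw [interior_Ioc, Set.mem_Ioo] at hx
      nlinarith
    have hr : StrictAntiOn (deriv (pbqu c1 c2)) (Set.Ico 0 b) := by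
      refine (strictAntiOn_quadSlope hc2 (convex_Ico _ _) fun x hx => ?_).congr fun x hx =>
        (deriv_pbqu_of_nonneg hc1 hc2 hx.1).symm
      rw [interior_Ico, Set.mem_Ioo] at hx
      nlinarith
    rw [← Set.Ioc_union_Ico_eq_Ioo (neg_lt_zero.2 h1) h2]
    exact hl.union hr (isGreatest_Ioc (neg_lt_zero.2 h1)) (isLeast_Ico h2)
  · refine (strictMonoOn_quadSlope hc2 (convex_Ioi _) fun x hx => ?_).congr fun x hx =>
      (deriv_pbqu_of_nonneg hc1 hc2 ?_).symm
    · rw [interior_Ioi, Set.mem_Ioi] at hx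
      nlinarith
    · rw [Set.mem_Ioi] at hx
      linarith
end

section
/- Let n ≥ 1 be a natural number and let l, c1, c2 > 0 be reals with c1 ≤ 2l and c1·c2 ≥ 8·√n·l². Then c1²/(4l² + c1²)² > n·c2²/(4l² + c2²)²; equivalently, f′(−2l) + n·f′(2l) > 0, where f′(−2l) = 4l·c1²/(4l² + c1²)² and f′(2l) = −4l·c2²/(4l² + c2²)². -/
theorem stmt_9 (n : ℕ) (hn : 1 ≤ n) (l c1 c2 : ℝ) (hl : 0 < l)
    (hc1 : 0 < c1) (hc2 : 0 < c2) (hc1l : c1 ≤ 2 * l)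
    (hcc : 8 * Real.sqrt n * l ^ 2 ≤ c1 * c2) :
    (n : ℝ) * c2 ^ 2 / (4 * l ^ 2 + c2 ^ 2) ^ 2 < c1 ^ 2 / (4 * l ^ 2 + c1 ^ 2) ^ 2 ∧
    0 < 4 * l * c1 ^ 2 / (4 * l ^ 2 + c1 ^ 2) ^ 2 +
      (n : ℝ) * (-(4 * l * c2 ^ 2 / (4 * l ^ 2 + c2 ^ 2) ^ 2)) := by
  have key : Real.sqrt n * c2 / (4 * l ^ 2 + c2 ^ 2) < c1 / (4 * l ^ 2 + c1 ^ 2) := by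
    rw [div_lt_div_iff₀ (by positivity) (by positivity)]
    have hsq : c1 ^ 2 ≤ 4 * l ^ 2 := by nlinarith
    calc Real.sqrt n * c2 * (4 * l ^ 2 + c1 ^ 2)
        ≤ Real.sqrt n * c2 * (4 * l ^ 2 + 4 * l ^ 2) := by gcongr
      _ = 8 * Real.sqrt n * l ^ 2 * c2 := by ring
      _ ≤ c1 * c2 * c2 := by gcongr
      _ < c1 * (4 * l ^ 2 + c2 ^ 2) := by
        have : 0 < c1 * (4 * l ^ 2) := by positivity
        linarith
  have main : (n : ℝ) * c2 ^ 2 / (4 * l ^ 2 + c2 ^ 2) ^ 2 <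
      c1 ^ 2 / (4 * l ^ 2 + c1 ^ 2) ^ 2 := by
    have h := pow_lt_pow_left₀ key (by positivity) two_ne_zero
    rwa [div_pow, div_pow, mul_pow, Real.sq_sqrt n.cast_nonneg] at h
  refine ⟨main, ?_⟩
  have h : 0 < 4 * l * (c1 ^ 2 / (4 * l ^ 2 + c1 ^ 2) ^ 2 -
      (n : ℝ) * c2 ^ 2 / (4 * l ^ 2 + c2 ^ 2) ^ 2) :=
    mul_pos (by positivity) (sub_pos.mpr main)
  convert h using 1
  ring
end
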